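/- There do not exist vectors u, v, w ∈ ℝ² such that ‖u‖² = 1/4, ‖v‖² = ‖w‖² = 21/40, and ‖u‖²‖v‖² − ⟨u,v⟩² = ‖u‖²‖w‖² − ⟨u,w⟩² = ‖v‖²‖w‖² − ⟨v,w⟩² = 1/10. (Thus the one- and two-mode correlations p₁ = 1/4, p₂ = p₃ = 21/40, p₁₂ = p₁₃ = p₂₃ = 1/10, which are realized by a complex 4×2 column-orthonormal matrix, cannot be realized by real vectors: complex entries are necessary.) -/

import Mathlib

open scoped RealInnerProductSpace

theorem stmt11 :
    ¬ ∃ u v w : EuclideanSpace ℝ (Fin 2),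
      ‖u‖ ^ 2 = 1 / 4 ∧ ‖v‖ ^ 2 = 21 / 40 ∧ ‖w‖ ^ 2 = 21 / 40 ∧
      ‖u‖ ^ 2 * ‖v‖ ^ 2 - ⟪u, v⟫ ^ 2 = 1 / 10 ∧
      ‖u‖ ^ 2 * ‖w‖ ^ 2 - ⟪u, w⟫ ^ 2 = 1 / 10 ∧
      ‖v‖ ^ 2 * ‖w‖ ^ 2 - ⟪v, w⟫ ^ 2 = 1 / 10 := by
  rintro ⟨u, v, w, hu, hv, hw, h1, h2, h3⟩
  have key : ‖u‖ ^ 2 * ‖v‖ ^ 2 * ‖w‖ ^ 2 + 2 * (⟪u, v⟫ * ⟪u, w⟫ * ⟪v, w⟫)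
      - ‖u‖ ^ 2 * ⟪v, w⟫ ^ 2 - ‖v‖ ^ 2 * ⟪u, w⟫ ^ 2 - ‖w‖ ^ 2 * ⟪u, v⟫ ^ 2 = 0 := by
    simp only [EuclideanSpace.real_norm_sq_eq, PiLp.inner_apply, Fin.sum_univ_two,
      RCLike.inner_apply, conj_trivial]
    ring
  rw [hu, hv, hw] at key
  rw [hu, hv] at h1
  rw [hu, hw] at h2
  rw [hv, hw] at h3
  generalize (⟪u, v⟫ : ℝ) = a at *
  generalize (⟪u, w⟫ : ℝ) = b at *
  generalize (⟪v, w⟫ : ℝ) = c at *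
  have ha : a ^ 2 = 1 / 32 := by linarith
  have hb : b ^ 2 = 1 / 32 := by linarith
  have hc : c ^ 2 = 281 / 1600 := by linarith
  rw [ha, hb, hc] at key
  have h : a * b * c = 1 / 256 := by linarith
  have h' : (a * b * c) ^ 2 = 1 / 32 * (1 / 32) * (281 / 1600) := by
    rw [mul_pow, mul_pow, ha, hb, hc]
  rw [h] at h'
  norm_num at h'
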